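/- For every vertex u of Γ, the pointwise stabilizer G_u^{[b+2]} of the ball of radius b+2 around u is trivial, where b is the critical distance. -/

import Mathlib

open MulAction Pointwise

/-- `V`, the `n`-dimensional vector space over the field with 3 elements. -/
abbrev Vec (n : ℕ) := Fin n → ZMod 3

/-- The translation subgroup `V` of `Perm (Vec n)`. -/
def TransGrp (n : ℕ) : Subgroup (Equiv.Perm (Vec n)) :=
  Subgroup.closure {f : Equiv.Perm (Vec n) | ∃ w, ∀ v, f v = v + w}

/-- The Frobenius group `L = V ⋊ C₂` of order `2·3^n`, acting on `V = Vec n`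
by `v ↦ ε·v + w` with `ε = ±1`: it is generated by the translations and negation. -/
def Lgrp (n : ℕ) : Subgroup (Equiv.Perm (Vec n)) :=
  Subgroup.closure ({f : Equiv.Perm (Vec n) | ∃ w, ∀ v, f v = v + w} ∪ {Equiv.neg (Vec n)})

/-- The pointwise stabilizer `G_u^{[s]}` in `G` of the ball of radius `s` around `u`. -/
def ballStab {α : Type*} (Γ : SimpleGraph α) (G : Type*) [Group G] [MulAction G α]
    (u : α) (s : ℕ) : Subgroup G :=
  ⨅ w ∈ {w : α | Γ.dist u w ≤ s}, stabilizer G w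

/-- `Z_{uw} = Ω₁(Z(G_u ∩ G_w))`, the subgroup generated by the elements of order at most 2
of the centre of the arc stabilizer `G_u ∩ G_w`. -/
def Zuw {α : Type*} (G : Type*) [Group G] [MulAction G α] (u w : α) : Subgroup G :=
  Subgroup.closure {g : G |
    g ∈ (stabilizer G u ⊓ stabilizer G w) ⊓
        Subgroup.centralizer ((stabilizer G u ⊓ stabilizer G w : Subgroup G) : Set G) ∧ g ^ 2 = 1}

/-- `Z_u = ⟨Z_{uw}^{G_u}⟩`, the normal closure in `G_u` of the subgroups `Z_{uw}`,
for `w` a neighbour of `u` (independent of the choice of `w` by arc-transitivity). -/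
def Zsub {α : Type*} (Γ : SimpleGraph α) (G : Type*) [Group G] [MulAction G α]
    (u : α) : Subgroup G :=
  Subgroup.closure {k : G | ∃ h ∈ stabilizer G u, ∃ w ∈ Γ.neighborSet u,
    ∃ g ∈ Zuw G u w, k = h * g * h⁻¹}

/-- The critical distance `b = min { d(u,v) : Z_u ≰ G_v^{[1]} }`. -/
noncomputable def critDist {α : Type*} (Γ : SimpleGraph α) (G : Type*) [Group G]
    [MulAction G α] : ℕ :=
  sInf {d : ℕ | ∃ u v : α, Γ.dist u v = d ∧ ¬ Zsub Γ G u ≤ ballStab Γ G v 1}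

/-- `(u,v)` is a critical pair: `d(u,v) = b` and `Z_u ≰ G_v^{[1]}`. -/
def critPair {α : Type*} (Γ : SimpleGraph α) (G : Type*) [Group G] [MulAction G α]
    (u v : α) : Prop :=
  Γ.dist u v = critDist Γ G ∧ ¬ Zsub Γ G u ≤ ballStab Γ G v 1

/-- `(Γ, G)` is locally `L`: for each vertex `u` there is a bijection
`φ : Γ(u) ≃ V` conjugating the permutation group induced by `G_u` on `Γ(u)`
to exactly the permutation group `L` acting on `V`. -/
def LocallyL {α : Type*} (n : ℕ) (Γ : SimpleGraph α) (G : Type*) [Group G]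
    [MulAction G α] : Prop :=
  ∀ u : α, ∃ φ : Γ.neighborSet u ≃ Vec n,
    (∀ g ∈ stabilizer G u, ∃ l ∈ Lgrp n, ∀ z : Γ.neighborSet u,
      ∃ hz : (g • (z : α)) ∈ Γ.neighborSet u, φ ⟨g • (z : α), hz⟩ = l (φ z)) ∧
    (∀ l ∈ Lgrp n, ∃ g ∈ stabilizer G u, ∀ z : Γ.neighborSet u,
      ∃ hz : (g • (z : α)) ∈ Γ.neighborSet u, φ ⟨g • (z : α), hz⟩ = l (φ z))

/-- Every element of `Lgrp n` has the form `v ↦ ± v + c`. -/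
theorem exists_of_mem_Lgrp {n : ℕ} {l : Equiv.Perm (Vec n)} (hl : l ∈ Lgrp n) :
    ∃ c, (∀ v, l v = v + c) ∨ (∀ v, l v = -v + c) := by
  unfold Lgrp at hl
  induction hl using Subgroup.closure_induction with
  | mem f hf =>
    rcases hf with ⟨w, hw⟩ | rfl
    · exact ⟨w, Or.inl hw⟩
    · exact ⟨0, Or.inr fun v => by simp⟩
  | one => exact ⟨0, Or.inl fun v => by simp⟩
  | mul f g _ _ hf hg =>
    obtain ⟨c, hc⟩ := hf
    obtain ⟨d, hd⟩ := hg
    rcases hc with hc | hc <;> rcases hd with hd | hd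
    · exact ⟨d + c, Or.inl fun v => by simp [hc, hd, add_assoc]⟩
    · exact ⟨d + c, Or.inr fun v => by simp [hc, hd, add_assoc]⟩
    · exact ⟨-d + c, Or.inr fun v => by rw [Equiv.Perm.mul_apply, hc, hd]; abel⟩
    · exact ⟨-d + c, Or.inl fun v => by rw [Equiv.Perm.mul_apply, hc, hd]; abel⟩
  | inv f _ hf =>
    obtain ⟨c, hc | hc⟩ := hf
    · exact ⟨-c, Or.inl fun v => by rw [Equiv.Perm.inv_eq_iff_eq, hc]; abel⟩
    · exact ⟨c, Or.inr fun v => by rw [Equiv.Perm.inv_eq_iff_eq, hc]; abel⟩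

section Action

variable {α : Type*} {Γ : SimpleGraph α} {G : Type*} [Group G] [MulAction G α]

theorem mem_ballStab {u : α} {s : ℕ} {g : G} :
    g ∈ ballStab Γ G u s ↔ ∀ w, Γ.dist u w ≤ s → g • w = w := by
  simp [ballStab, Subgroup.mem_iInf]

theorem mem_ballStab_one (hconn : Γ.Connected) {u : α} {g : G} :
    g ∈ ballStab Γ G u 1 ↔ g • u = u ∧ ∀ w, Γ.Adj u w → g • w = w := by
  rw [mem_ballStab]
  constructor
  · exact fun h => ⟨h u (by simp), fun w hw => h w (SimpleGraph.dist_eq_one_iff_adj.2 hw).le⟩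
  · rintro ⟨h1, h2⟩ w hw
    rcases Nat.le_one_iff_eq_zero_or_eq_one.1 hw with h | h
    · rw [← hconn.dist_eq_zero_iff.1 h, h1]
    · exact h2 w (SimpleGraph.dist_eq_one_iff_adj.1 h)

theorem graphDist_smul (haut : ∀ (g : G) (u w : α), Γ.Adj u w ↔ Γ.Adj (g • u) (g • w))
    (hconn : Γ.Connected) (g : G) (u w : α) : Γ.dist (g • u) (g • w) = Γ.dist u w := by
  have key : ∀ (g : G) (u w : α), Γ.dist (g • u) (g • w) ≤ Γ.dist u w := by
    intro g u w
    obtain ⟨p, hp⟩ := hconn.exists_walk_length_eq_dist u w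
    let f : Γ →g Γ := ⟨fun a => g • a, fun {a b} h => (haut g a b).1 h⟩
    rw [← hp, ← SimpleGraph.Walk.length_map f p]
    exact SimpleGraph.dist_le (p.map f)
  refine le_antisymm (key g u w) ?_
  simpa using key g⁻¹ (g • u) (g • w)

theorem conj_mem_ballStab (haut : ∀ (g : G) (u w : α), Γ.Adj u w ↔ Γ.Adj (g • u) (g • w))
    (hconn : Γ.Connected) {u : α} {s : ℕ} {g : G} (hg : g ∈ ballStab Γ G u s) (h : G) :
    h * g * h⁻¹ ∈ ballStab Γ G (h • u) s := by
  rw [mem_ballStab] at hg ⊢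
  intro w hw
  have := hg (h⁻¹ • w) (by rw [← graphDist_smul haut hconn h]; simpa using hw)
  rw [mul_smul, mul_smul, this, smul_inv_smul]

theorem conj_mem_ballStab_iff (haut : ∀ (g : G) (u w : α), Γ.Adj u w ↔ Γ.Adj (g • u) (g • w))
    (hconn : Γ.Connected) {u : α} {s : ℕ} {g h : G} :
    h * g * h⁻¹ ∈ ballStab Γ G (h • u) s ↔ g ∈ ballStab Γ G u s := by
  refine ⟨fun H => ?_, fun H => conj_mem_ballStab haut hconn H h⟩
  have := conj_mem_ballStab haut hconn H h⁻¹
  simpa [mul_assoc] using this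

theorem conj_mem_stabilizer {u : α} {g : G} (hg : g ∈ stabilizer G u) (h : G) :
    h * g * h⁻¹ ∈ stabilizer G (h • u) := by
  rw [mem_stabilizer_iff] at hg ⊢
  rw [mul_smul, mul_smul, inv_smul_smul, hg]

/-- The elements of the centre of the arc stabilizer. -/
def arcCentre (G : Type*) [Group G] [MulAction G α] (u w : α) : Subgroup G :=
  (stabilizer G u ⊓ stabilizer G w) ⊓
    Subgroup.centralizer ((stabilizer G u ⊓ stabilizer G w : Subgroup G) : Set G)

theorem Zuw_le_arcCentre (u w : α) : Zuw G u w ≤ arcCentre G u w := by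
  unfold Zuw
  rw [Subgroup.closure_le]
  exact fun g hg => hg.1

theorem conj_mem_arcCentre {u w : α} {g : G} (hg : g ∈ arcCentre G u w) (h : G) :
    h * g * h⁻¹ ∈ arcCentre G (h • u) (h • w) := by
  obtain ⟨⟨h1, h2⟩, h3⟩ := hg
  refine ⟨⟨conj_mem_stabilizer h1 h, conj_mem_stabilizer h2 h⟩, ?_⟩
  have h3 := Subgroup.mem_centralizer_iff.1 h3
  refine Subgroup.mem_centralizer_iff.2 ?_
  rintro k ⟨k1, k2⟩
  have := h3 (h⁻¹ * k * h) ⟨by simpa using conj_mem_stabilizer k1 h⁻¹,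
    by simpa using conj_mem_stabilizer k2 h⁻¹⟩
  calc k * (h * g * h⁻¹) = h * ((h⁻¹ * k * h) * g) * h⁻¹ := by group
    _ = h * (g * (h⁻¹ * k * h)) * h⁻¹ := by rw [this]
    _ = h * g * h⁻¹ * k := by group

theorem conj_mem_Zuw {u w : α} {g : G} (hg : g ∈ Zuw G u w) (h : G) :
    h * g * h⁻¹ ∈ Zuw G (h • u) (h • w) := by
  have key : Zuw G u w ≤ (Zuw G (h • u) (h • w)).comap (MulAut.conj h).toMonoidHom := by
    rw [Zuw, Subgroup.closure_le]
    rintro g ⟨hg, hg2⟩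
    refine Subgroup.subset_closure ⟨conj_mem_arcCentre hg h, ?_⟩
    change (h * g * h⁻¹) ^ 2 = 1
    rw [conj_pow, hg2]; group
  exact key hg

theorem conj_mem_Zsub (haut : ∀ (g : G) (u w : α), Γ.Adj u w ↔ Γ.Adj (g • u) (g • w))
    {u : α} {z : G} (hz : z ∈ Zsub Γ G u) (h : G) : h * z * h⁻¹ ∈ Zsub Γ G (h • u) := by
  have key : Zsub Γ G u ≤ (Zsub Γ G (h • u)).comap (MulAut.conj h).toMonoidHom := by
    rw [Zsub, Subgroup.closure_le]
    rintro z ⟨k, hk, w, hw, g, hg, rfl⟩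
    refine Subgroup.subset_closure ⟨h * k * h⁻¹, conj_mem_stabilizer hk h, h • w,
      (haut h u w).1 hw, h * g * h⁻¹, conj_mem_Zuw hg h, ?_⟩
    change h * (k * g * k⁻¹) * h⁻¹ = _
    group
  exact key hz

theorem Zuw_le_Zsub {u w : α} (h : Γ.Adj u w) : Zuw G u w ≤ Zsub Γ G u :=
  fun g hg => Subgroup.subset_closure ⟨1, one_mem _, w, h, g, hg, by simp⟩

/-- An element of an arc stabilizer squares into the kernel of the local action. -/
theorem sq_mem_ballStab_one {n : ℕ} (hconn : Γ.Connected) (hloc : LocallyL n Γ G) {u w : α}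
    (huw : Γ.Adj u w) {g : G} (hu : g • u = u) (hw : g • w = w) :
    g ^ 2 ∈ ballStab Γ G u 1 := by
  obtain ⟨φ, h1, -⟩ := hloc u
  obtain ⟨l, hl, hgl⟩ := h1 g hu
  obtain ⟨hz, hfix⟩ := hgl ⟨w, huw⟩
  simp only [hw] at hfix
  have hll : ∀ v, l (l v) = v := by
    obtain ⟨c, hc | hc⟩ := exists_of_mem_Lgrp hl
    · have : c = 0 := by simpa [hc] using hfix
      intro v; simp [hc, this]
    · intro v; simp [hc]
  rw [mem_ballStab_one hconn]
  refine ⟨by rw [pow_two, mul_smul, hu, hu], fun a ha => ?_⟩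
  obtain ⟨hz1, e1⟩ := hgl ⟨a, ha⟩
  obtain ⟨hz2, e2⟩ := hgl ⟨g • a, hz1⟩
  rw [e1, hll] at e2
  rw [pow_two, mul_smul]
  exact congrArg Subtype.val (φ.injective e2)

/-- The conjugates of an element of an arc stabilizer acting nontrivially on the neighbourhood
move every neighbour to every other one. -/
theorem exists_conj_smul_eq {n : ℕ} (hconn : Γ.Connected) (hloc : LocallyL n Γ G) {u w : α}
    (huw : Γ.Adj u w) {g : G} (hu : g • u = u) (hw : g • w = w) (hg : g ∉ ballStab Γ G u 1)
    {a b : α} (ha : Γ.Adj u a) (hb : Γ.Adj u b) :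
    ∃ h ∈ stabilizer G u, (h * g * h⁻¹) • a = b := by
  obtain ⟨φ, h1, h2⟩ := hloc u
  obtain ⟨l, hl, hgl⟩ := h1 g hu
  obtain ⟨hz, hfix⟩ := hgl ⟨w, huw⟩
  simp only [hw] at hfix
  obtain ⟨c, hc | hc⟩ := exists_of_mem_Lgrp hl
  · have hc0 : c = 0 := by simpa [hc] using hfix
    refine absurd ((mem_ballStab_one hconn).2 ⟨hu, fun a ha => ?_⟩) hg
    obtain ⟨hz1, e1⟩ := hgl ⟨a, ha⟩
    rw [hc, hc0, add_zero] at e1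
    exact congrArg Subtype.val (φ.injective e1)
  · set d : Vec n := -(φ ⟨b, hb⟩ + φ ⟨a, ha⟩ - c) with hd
    obtain ⟨h, hh, ht⟩ := h2 (Equiv.addRight d) (Subgroup.subset_closure (Or.inl ⟨d, fun _ => rfl⟩))
    refine ⟨h, hh, ?_⟩
    obtain ⟨p, hp⟩ : ∃ p : Γ.neighborSet u, φ p = φ ⟨a, ha⟩ - d :=
      ⟨φ.symm (φ ⟨a, ha⟩ - d), φ.apply_symm_apply _⟩
    have hpa : h • (p : α) = a := by
      obtain ⟨hz1, e1⟩ := ht p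
      rw [hp] at e1
      refine congrArg Subtype.val (φ.injective (a₂ := ⟨a, ha⟩) (e1.trans ?_))
      simp
    obtain ⟨hz1, e1⟩ := hgl p
    obtain ⟨hz2, e2⟩ := ht ⟨g • (p : α), hz1⟩
    have : h • g • (p : α) = b := by
      refine congrArg Subtype.val (φ.injective (a₁ := ⟨_, hz2⟩) (a₂ := ⟨b, hb⟩) (e2.trans ?_))
      rw [e1, hc, hp, Equiv.coe_addRight, hd]
      funext i
      have h3 : (3 : ZMod 3) = 0 := rfl
      simp only [Pi.add_apply, Pi.neg_apply, Pi.sub_apply]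
      linear_combination (- φ ⟨b, hb⟩ i - φ ⟨a, ha⟩ i + c i) * h3
    rw [mul_smul, mul_smul, ← hpa, inv_smul_smul, this]

/-- In a connected graph, a property of vertices passing to neighbours holds everywhere. -/
theorem forall_of_adj (hconn : Γ.Connected) {p : α → Prop} {u : α} (hu : p u)
    (hstep : ∀ v v', Γ.Adj v v' → p v → p v') (v : α) : p v := by
  obtain ⟨q⟩ := hconn.preconnected u v
  induction q with
  | nil => exact hu
  | cons h _ ih => exact ih (hstep _ _ h hu)

/-- A subgroup of an arc stabilizer whose normalizer moves both ends of the arc to all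
neighbours of the opposite end is trivial. -/
theorem eq_bot_of_normalizer (haut : ∀ (g : G) (u w : α), Γ.Adj u w ↔ Γ.Adj (g • u) (g • w))
    (hconn : Γ.Connected) (hfaith : ∀ g : G, (∀ u : α, g • u = u) → g = 1) {u w : α}
    {P : Subgroup G} (hPu : P ≤ stabilizer G u) (hPw : P ≤ stabilizer G w)
    (hu : ∀ a, Γ.Adj u a → ∃ k ∈ Subgroup.normalizer (P : Set G), k • w = a)
    (hw : ∀ a, Γ.Adj w a → ∃ k ∈ Subgroup.normalizer (P : Set G), k • u = a) : P = ⊥ := by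
  have key : ∀ v, ∃ k ∈ Subgroup.normalizer (P : Set G), k • u = v ∨ k • w = v := by
    refine forall_of_adj hconn ⟨1, one_mem _, Or.inl (one_smul _ u)⟩ ?_
    rintro v v' hv ⟨k, hk, rfl | rfl⟩
    · obtain ⟨k', hk', e⟩ := hu (k⁻¹ • v') (by rw [haut k]; simpa using hv)
      exact ⟨k * k', mul_mem hk hk', Or.inr (by rw [mul_smul, e, smul_inv_smul])⟩
    · obtain ⟨k', hk', e⟩ := hw (k⁻¹ • v') (by rw [haut k]; simpa using hv)
      exact ⟨k * k', mul_mem hk hk', Or.inl (by rw [mul_smul, e, smul_inv_smul])⟩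
  rw [Subgroup.eq_bot_iff_forall]
  refine fun p hp => hfaith p fun v => ?_
  obtain ⟨k, hk, h⟩ := key v
  have hpk : k⁻¹ * p * k ∈ P := by
    simpa using (Subgroup.mem_normalizer_iff.1 (inv_mem hk) p).1 hp
  have e : p = k * (k⁻¹ * p * k) * k⁻¹ := by group
  rw [e]
  rcases h with rfl | rfl
  · exact conj_mem_stabilizer (hPu hpk) k
  · exact conj_mem_stabilizer (hPw hpk) k

theorem mem_normalizer_of_commute {P : Subgroup G} {k : G} (h : ∀ p ∈ P, Commute k p) :
    k ∈ Subgroup.normalizer (P : Set G) :=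
  Subgroup.centralizer_le_normalizer _ (Subgroup.mem_centralizer_iff.2 fun p hp => (h p hp).symm)

theorem commute_conj {k q h : G} (H : Commute k (h⁻¹ * q * h)) : Commute (h * k * h⁻¹) q := by
  have := H.eq
  change h * k * h⁻¹ * q = q * (h * k * h⁻¹)
  calc h * k * h⁻¹ * q = h * (k * (h⁻¹ * q * h)) * h⁻¹ := by group
    _ = q * (h * k * h⁻¹) := by rw [this]; group

theorem isPGroup_arc_stabilizer {n : ℕ} (hconn : Γ.Connected)
    (hfaith : ∀ g : G, (∀ u : α, g • u = u) → g = 1) (hfin : ∀ u : α, Finite (stabilizer G u))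
    (hloc : LocallyL n Γ G) {u w : α} (huw : Γ.Adj u w) {g : G} (hu : g • u = u)
    (hw : g • w = w) : ∃ k, g ^ 2 ^ k = 1 := by
  have : Finite (stabilizer G u) := hfin u
  have hpos : 0 < orderOf g := by
    rw [← Subgroup.orderOf_mk g (show g ∈ stabilizer G u from hu)]
    exact orderOf_pos _
  obtain ⟨k, m, hm, hkm⟩ := Nat.exists_eq_two_pow_mul_odd hpos.ne'
  refine ⟨k, hfaith _ ?_⟩
  set h := g ^ 2 ^ k with hh
  have hord : h ^ m = 1 := by rw [hh, ← pow_mul, ← hkm, pow_orderOf_eq_one]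
  have hfix : ∀ v v', Γ.Adj v v' → h • v = v → h • v' = v' → h ∈ ballStab Γ G v 1 := by
    intro v v' hv h1 h2
    obtain ⟨j, rfl⟩ := hm
    have hsq := pow_mem (inv_mem (sq_mem_ballStab_one hconn hloc hv h1 h2)) j
    have : h = ((h ^ 2)⁻¹) ^ j := by
      rw [inv_pow, ← pow_mul, eq_inv_iff_mul_eq_one, ← pow_succ', hord]
    rwa [this]
  have hfixes : ∀ v : α, g • v = v → h • v = v := fun v hv => by
    have : g ∈ stabilizer G v := hv
    exact pow_mem this (2 ^ k)
  have all := forall_of_adj hconn (p := fun v => h ∈ ballStab Γ G v 1)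
    (hfix u w huw (hfixes u hu) (hfixes w hw)) (by
      intro v v' hv hmem
      rw [mem_ballStab_one hconn] at hmem
      exact hfix v' v hv.symm (hmem.2 v' hv) hmem.1)
  exact fun v => ((mem_ballStab_one hconn).1 (all v)).1

/-- A nontrivial finite arc stabilizer has a central involution. -/
theorem Zuw_ne_bot {n : ℕ} (hconn : Γ.Connected)
    (hfaith : ∀ g : G, (∀ u : α, g • u = u) → g = 1) (hfin : ∀ u : α, Finite (stabilizer G u))
    (hloc : LocallyL n Γ G) {u w : α} (huw : Γ.Adj u w)
    (hne : stabilizer G u ⊓ stabilizer G w ≠ ⊥) : Zuw G u w ≠ ⊥ := by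
  set S := stabilizer G u ⊓ stabilizer G w with hS
  have : Finite (stabilizer G u) := hfin u
  have : Finite S := Finite.Set.subset (stabilizer G u : Set G) fun g hg => hg.1
  have : Nontrivial S := (Subgroup.nontrivial_iff_ne_bot S).2 hne
  have : Fact (Nat.Prime 2) := ⟨Nat.prime_two⟩
  have hp : IsPGroup 2 S := by
    rintro ⟨g, hg⟩
    obtain ⟨k, hk⟩ := isPGroup_arc_stabilizer hconn hfaith hfin hloc huw hg.1 hg.2
    exact ⟨k, Subtype.ext hk⟩
  have := hp.center_nontrivial
  have hdvd : 2 ∣ Nat.card (Subgroup.center S) := by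
    obtain ⟨k, hk, e⟩ := (hp.to_subgroup (Subgroup.center S)).nontrivial_iff_card.1 this
    rw [e]
    exact dvd_pow_self 2 hk.ne'
  obtain ⟨⟨⟨z, hzS⟩, hzc⟩, hz⟩ := exists_prime_orderOf_dvd_card' 2 hdvd
  simp only [Subgroup.orderOf_mk] at hz
  intro hbot
  have hmem : z ∈ Zuw G u w := by
    refine Subgroup.subset_closure ⟨⟨hzS, ?_⟩, by rw [← hz, pow_orderOf_eq_one]⟩
    refine Subgroup.mem_centralizer_iff.2 ?_
    intro g hg
    exact congrArg Subtype.val (Subgroup.mem_center_iff.1 hzc ⟨g, hg⟩)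
  rw [hbot, Subgroup.mem_bot] at hmem
  rw [hmem, orderOf_one] at hz
  omega

/-- If the pointwise stabilizer of the union of the two balls of radius one around an edge is
nontrivial, then the centre of an arc stabilizer acts trivially on the neighbourhood. -/
theorem arcCentre_le_ballStab_one {n : ℕ} (hconn : Γ.Connected)
    (haut : ∀ (g : G) (u w : α), Γ.Adj u w ↔ Γ.Adj (g • u) (g • w))
    (hfaith : ∀ g : G, (∀ u : α, g • u = u) → g = 1)
    (harc : ∀ u w u' w' : α, Γ.Adj u w → Γ.Adj u' w' → ∃ g : G, g • u = u' ∧ g • w = w')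
    (hloc : LocallyL n Γ G) {x y : α} (hxy : Γ.Adj x y)
    (hntriv : ballStab Γ G x 1 ⊓ ballStab Γ G y 1 ≠ ⊥) {u w : α} (huw : Γ.Adj u w) :
    arcCentre G u w ≤ ballStab Γ G u 1 := by
  intro g hg
  by_contra hgu
  have half : ∀ u w : α, Γ.Adj u w → ∀ g ∈ arcCentre G u w, g ∉ ballStab Γ G u 1 →
      ∀ a, Γ.Adj u a → ∃ k ∈ Subgroup.normalizer
        ((ballStab Γ G u 1 ⊓ ballStab Γ G w 1 : Subgroup G) : Set G), k • w = a := by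
    intro u w huw g hg hgu a ha
    obtain ⟨h, hh, e⟩ := exists_conj_smul_eq hconn hloc huw hg.1.1 hg.1.2 hgu huw ha
    refine ⟨_, mem_normalizer_of_commute fun p hp => commute_conj ?_, e⟩
    have hp' := conj_mem_ballStab haut hconn hp.1 h⁻¹
    rw [mem_stabilizer_iff.1 (inv_mem hh), inv_inv, mem_ballStab_one hconn] at hp'
    exact (Subgroup.mem_centralizer_iff.1 hg.2 _ ⟨hp'.1, hp'.2 w huw⟩).symm
  have toXY : ∀ g' u' w', Γ.Adj u' w' → g' ∈ arcCentre G u' w' → g' ∉ ballStab Γ G u' 1 →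
      ∀ p q, Γ.Adj p q → ∃ k ∈ arcCentre G p q, k ∉ ballStab Γ G p 1 := by
    intro g' u' w' h1 h2 h3 p q hpq
    obtain ⟨f, rfl, rfl⟩ := harc u' w' p q h1 hpq
    exact ⟨_, conj_mem_arcCentre h2 f, fun H => h3 ((conj_mem_ballStab_iff haut hconn).1 H)⟩
  obtain ⟨k, hk, hkx⟩ := toXY g u w huw hg hgu x y hxy
  obtain ⟨k', hk', hky⟩ := toXY g u w huw hg hgu y x hxy.symm
  refine hntriv (eq_bot_of_normalizer haut hconn hfaith
    (fun p hp => ((mem_ballStab_one hconn).1 hp.1).1)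
    (fun p hp => ((mem_ballStab_one hconn).1 hp.2).1) (half x y hxy k hk hkx) ?_)
  rw [inf_comm]
  exact half y x hxy.symm k' hk' hky

theorem Zsub_le_ballStab_one_inf_centralizer {u : α} (hconn : Γ.Connected)
    (haut : ∀ (g : G) (u w : α), Γ.Adj u w ↔ Γ.Adj (g • u) (g • w))
    (hcentre : ∀ u w : α, Γ.Adj u w → arcCentre G u w ≤ ballStab Γ G u 1) :
    Zsub Γ G u ≤ ballStab Γ G u 1 ⊓ Subgroup.centralizer (ballStab Γ G u 1 : Set G) := by
  rw [Zsub, Subgroup.closure_le]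
  rintro _ ⟨h, hh, w, hw, g, hg, rfl⟩
  have hg' := Zuw_le_arcCentre u w hg
  constructor
  · have := conj_mem_ballStab haut hconn (hcentre u w hw hg') h
    rwa [mem_stabilizer_iff.1 hh] at this
  · refine Subgroup.mem_centralizer_iff.2 ?_
    intro q hq
    refine (commute_conj ?_ : Commute (h * g * h⁻¹) q).symm
    have hq' := conj_mem_ballStab haut hconn hq h⁻¹
    rw [mem_stabilizer_iff.1 (inv_mem hh), inv_inv, mem_ballStab_one hconn] at hq'
    exact (Subgroup.mem_centralizer_iff.1 hg'.2 _ ⟨hq'.1, hq'.2 w hw⟩).symm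

/-- A vertex other than `u` has a neighbour closer to `u`. -/
theorem exists_adj_dist_lt (hconn : Γ.Connected) {u v : α} (h : u ≠ v) :
    ∃ w, Γ.Adj v w ∧ Γ.dist u w < Γ.dist u v := by
  obtain ⟨p, hp⟩ := hconn.exists_walk_length_eq_dist v u
  cases p with
  | nil => exact absurd rfl h
  | @cons _ w _ hw q =>
    refine ⟨w, hw, ?_⟩
    rw [SimpleGraph.dist_comm, SimpleGraph.dist_comm (u := u) (v := v), ← hp,
      SimpleGraph.Walk.length_cons, Nat.lt_succ_iff]
    exact SimpleGraph.dist_le q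

end Action

/-- for every vertex `u`, the pointwise stabilizer `G_u^{[b+2]}` of the
ball of radius `b+2` around `u` is trivial. -/
theorem ballStab_critDist_add_two_eq_bot
    {α : Type*} (n : ℕ) (hn : 2 ≤ n) (Γ : SimpleGraph α)
    (G : Type*) [Group G] [MulAction G α]
    (hconn : Γ.Connected) (hacyc : Γ.IsAcyclic)
    (haut : ∀ (g : G) (u w : α), Γ.Adj u w ↔ Γ.Adj (g • u) (g • w))
    (hfaith : ∀ g : G, (∀ u : α, g • u = u) → g = 1)
    (harc : ∀ u w u' w' : α, Γ.Adj u w → Γ.Adj u' w' → ∃ g : G, g • u = u' ∧ g • w = w')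
    (hfin : ∀ u : α, Finite (stabilizer G u))
    (hloc : LocallyL n Γ G)
    (x y : α) (hxy : Γ.Adj x y)
    (hntriv : ballStab Γ G x 1 ⊓ ballStab Γ G y 1 ≠ ⊥)
 :
    ∀ u : α, ballStab Γ G u (critDist Γ G + 2) = ⊥ := by
  have hcentre : ∀ u w : α, Γ.Adj u w → arcCentre G u w ≤ ballStab Γ G u 1 := fun u w huw =>
    arcCentre_le_ballStab_one hconn haut hfaith harc hloc hxy hntriv huw
  have hZ : ∀ u, Zsub Γ G u ≤
      ballStab Γ G u 1 ⊓ Subgroup.centralizer (ballStab Γ G u 1 : Set G) := fun u =>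
    Zsub_le_ballStab_one_inf_centralizer hconn haut hcentre
  have hnonempty : {d : ℕ | ∃ u v : α, Γ.dist u v = d ∧
      ¬ Zsub Γ G u ≤ ballStab Γ G v 1}.Nonempty := by
    by_contra hempty
    have hall : ∀ v, Zsub Γ G x ≤ ballStab Γ G v 1 := by
      by_contra! h
      obtain ⟨v, hv⟩ := h
      exact hempty ⟨_, x, v, rfl, hv⟩
    refine Zuw_ne_bot hconn hfaith hfin hloc hxy (fun h => hntriv ?_)
      ((Subgroup.eq_bot_iff_forall _).2 fun g hg => hfaith g fun v =>
        ((mem_ballStab_one hconn).1 (hall v (Zuw_le_Zsub hxy hg))).1)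
    rw [eq_bot_iff, ← h]
    exact fun g hg => ⟨((mem_ballStab_one hconn).1 hg.1).1, ((mem_ballStab_one hconn).1 hg.2).1⟩
  obtain ⟨u₀, v₀, hd, hcrit⟩ := Nat.sInf_mem hnonempty
  change Γ.dist u₀ v₀ = critDist Γ G at hd
  have hlt : ∀ v, Γ.dist u₀ v < critDist Γ G → Zsub Γ G u₀ ≤ ballStab Γ G v 1 := by
    intro v hv
    by_contra h
    exact Nat.notMem_of_lt_sInf hv ⟨u₀, v, rfl, h⟩
  obtain ⟨z, hz, hzv⟩ := SetLike.not_le_iff_exists.1 hcrit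
  have hne : u₀ ≠ v₀ := by
    rintro rfl
    exact hzv (hZ _ hz).1
  obtain ⟨w₀, hw₀, hdw⟩ := exists_adj_dist_lt hconn hne
  have hzw := (mem_ballStab_one hconn).1 (hlt w₀ (hd ▸ hdw) hz)
  have hzv₀ : z • v₀ = v₀ := hzw.2 v₀ hw₀.symm
  have key : ∀ u a b : α, Γ.Adj u a → Γ.Adj u b → ∃ v', Γ.dist u v' ≤ critDist Γ G ∧
      ∃ k ∈ Zsub Γ G v', k • a = b := by
    intro u a b ha hb
    obtain ⟨f, rfl, rfl⟩ := harc v₀ w₀ u a hw₀ ha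
    have hnot : f * z * f⁻¹ ∉ ballStab Γ G (f • v₀) 1 := fun H =>
      hzv ((conj_mem_ballStab_iff haut hconn).1 H)
    obtain ⟨h, hh, e⟩ := exists_conj_smul_eq hconn hloc ha
      (conj_mem_stabilizer (mem_stabilizer_iff.2 hzv₀) f)
      (conj_mem_stabilizer (mem_stabilizer_iff.2 hzw.1) f) hnot ha hb
    refine ⟨h • f • u₀, ?_, h * (f * z * f⁻¹) * h⁻¹, conj_mem_Zsub haut (conj_mem_Zsub haut hz f) h, e⟩
    conv_lhs => rw [← mem_stabilizer_iff.1 hh]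
    rw [graphDist_smul haut hconn, graphDist_smul haut hconn, SimpleGraph.dist_comm, hd]
  intro u
  obtain ⟨w, huw⟩ : ∃ w, Γ.Adj u w := by
    obtain ⟨φ, -⟩ := hloc u
    exact ⟨_, (φ.symm 0).2⟩
  have hcomm : ∀ v', Γ.dist u v' ≤ critDist Γ G + 1 → ∀ k ∈ Zsub Γ G v',
      k ∈ Subgroup.normalizer (ballStab Γ G u (critDist Γ G + 2) : Set G) := by
    intro v' hv' k hk
    refine mem_normalizer_of_commute fun p hp => ?_
    refine (Subgroup.mem_centralizer_iff.1 (hZ v' hk).2 p ?_).symm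
    rw [SetLike.mem_coe, mem_ballStab]
    rw [mem_ballStab] at hp
    intro a ha
    have := hconn.dist_triangle (u := u) (v := v') (w := a)
    exact hp a (by omega)
  have huw1 := SimpleGraph.dist_eq_one_iff_adj.2 huw
  refine eq_bot_of_normalizer haut hconn hfaith (u := u) (w := w)
    (fun p hp => mem_ballStab.1 hp u (by simp)) (fun p hp => mem_ballStab.1 hp w (by omega)) ?_ ?_
  · intro a ha
    obtain ⟨v', hv', k, hk, e⟩ := key u w a huw ha
    exact ⟨k, hcomm v' (by omega) k hk, e⟩
  · intro a ha
    obtain ⟨v', hv', k, hk, e⟩ := key w u a huw.symm ha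
    have := hconn.dist_triangle (u := u) (v := w) (w := v')
    exact ⟨k, hcomm v' (by omega) k hk, e⟩
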